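/- arXiv:2407.18688 — 3 statements merged into one kernel-verified Lean document; each statement's English description precedes it below -/
import Mathlib

section
/- Let k be an even positive integer and let n be an integer with k + 1 ≤ n. Then for every p ∈ [0,1], M(n, k+1, p) = p · M(n−1, k, p). -/
open scoped BigOperators

noncomputable section

/-- The probability, under the mass function `f` on `{0,1}^n`, of the event that
all coordinates in `S` equal `1` (i.e. `true`). -/
def prAll {n : ℕ} (f : (Fin n → Bool) → ℝ) (S : Finset (Fin n)) : ℝ :=
  ∑ x ∈ Finset.univ.filter (fun x : Fin n → Bool => ∀ i ∈ S, x i = true), f x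

/-- `f` is the mass function of a probability measure on `{0,1}^n` making the
coordinate random variables `k`-wise independent Bernoulli(`p`) bits:
`P(X_{i₁} = ⋯ = X_{i_s} = 1) = p ^ s` for all `1 ≤ s ≤ k`. -/
def memA (n k : ℕ) (p : ℝ) (f : (Fin n → Bool) → ℝ) : Prop :=
  (∀ x, 0 ≤ f x) ∧ (∑ x, f x) = 1 ∧
    ∀ S : Finset (Fin n), 1 ≤ S.card → S.card ≤ k → prAll f S = p ^ S.card

/-- `M n k p`: the maximum of `P(X₁ = ⋯ = Xₙ = 1)` over `A(n,k,p)`. -/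
def M (n k : ℕ) (p : ℝ) : ℝ :=
  sSup {y : ℝ | ∃ f, memA n k p f ∧ prAll f Finset.univ = y}

/-- Bonferroni polynomial `B(m,l,x) = Σ_{i=0}^{l} (−1)^i C(m,i) x^i`;
by convention it is `0` for negative `l`. -/
def bonf (m : ℕ) (l : ℤ) (x : ℝ) : ℝ :=
  if l < 0 then 0
  else ∑ i ∈ Finset.range (l.toNat + 1), (-1 : ℝ) ^ i * (m.choose i) * x ^ i

/-- `q` is the mass function of a law on `{0, …, n}` whose binomial moments up to order `k` agree
with those of the binomial distribution `Bin(n, p)`. -/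
def IsProfile (n k : ℕ) (p : ℝ) (q : ℕ → ℝ) : Prop :=
  (∀ j, 0 ≤ q j) ∧ (∀ j, n < j → q j = 0) ∧
    ∀ s ≤ k, ∑ j ∈ Finset.range (n + 1), q j * (j.choose s : ℝ) = (n.choose s : ℝ) * p ^ s

/-- The set of coordinates equal to `1`. -/
def ones {n : ℕ} (x : Fin n → Bool) : Finset (Fin n) :=
  Finset.univ.filter (fun i => x i = true)

lemma subset_ones_iff {n : ℕ} {x : Fin n → Bool} {S : Finset (Fin n)} :
    S ⊆ ones x ↔ ∀ i ∈ S, x i = true := by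
  simp [ones, Finset.subset_iff]

lemma prAll_eq_sum_ite {n : ℕ} (f : (Fin n → Bool) → ℝ) (S : Finset (Fin n)) :
    prAll f S = ∑ x, if S ⊆ ones x then f x else 0 := by
  simp only [prAll, Finset.sum_filter, subset_ones_iff]

lemma prAll_empty {n : ℕ} (f : (Fin n → Bool) → ℝ) : prAll f ∅ = ∑ x, f x := by
  simp [prAll]

lemma memA.prAll_eq {n k : ℕ} {p : ℝ} {f : (Fin n → Bool) → ℝ} (hf : memA n k p f)
    (S : Finset (Fin n)) (hS : S.card ≤ k) : prAll f S = p ^ S.card := by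
  rcases S.eq_empty_or_nonempty with rfl | h
  · simp [prAll_empty, hf.2.1]
  · exact hf.2.2 S h.card_pos hS

lemma sum_ones {n : ℕ} (F : Finset (Fin n) → ℝ) :
    ∑ x : Fin n → Bool, F (ones x) = ∑ T, F T := by
  refine Finset.sum_nbij' ones (fun T i => decide (i ∈ T)) ?_ ?_ ?_ ?_ ?_ <;> simp [ones]

lemma card_ones_lt {n : ℕ} (x : Fin n → Bool) : (ones x).card < n + 1 :=
  Nat.lt_succ_of_le ((Finset.card_le_univ _).trans_eq (Fintype.card_fin n))

/-- The distribution of the number of ones. -/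
def weightLaw {n : ℕ} (f : (Fin n → Bool) → ℝ) (j : ℕ) : ℝ :=
  ∑ x with (ones x).card = j, f x

lemma weightLaw_self {n : ℕ} (f : (Fin n → Bool) → ℝ) :
    weightLaw f n = prAll f Finset.univ := by
  refine Finset.sum_congr (Finset.filter_congr fun x _ => ?_) fun _ _ => rfl
  rw [← subset_ones_iff, Finset.univ_subset_iff, ← Finset.card_eq_iff_eq_univ, Fintype.card_fin]

lemma isProfile_weightLaw {n k : ℕ} {p : ℝ} {f : (Fin n → Bool) → ℝ} (hf : memA n k p f) :
    IsProfile n k p (weightLaw f) := by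
  refine ⟨fun j => Finset.sum_nonneg fun x _ => hf.1 x, fun j hj => ?_, fun s hs => ?_⟩
  · refine Finset.sum_eq_zero fun x hx => ?_
    have := card_ones_lt x
    simp only [Finset.mem_filter] at hx
    omega
  · calc ∑ j ∈ Finset.range (n + 1), weightLaw f j * (j.choose s : ℝ)
        = ∑ j ∈ Finset.range (n + 1), ∑ x with (ones x).card = j,
            f x * ((ones x).card.choose s : ℝ) := by
          refine Finset.sum_congr rfl fun j _ => ?_
          rw [weightLaw, Finset.sum_mul]
          refine Finset.sum_congr rfl fun x hx => ?_
          rw [(Finset.mem_filter.1 hx).2]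
      _ = ∑ x, f x * ((ones x).card.choose s : ℝ) :=
          Finset.sum_fiberwise_of_maps_to (fun x _ => Finset.mem_range.2 (card_ones_lt x)) _
      _ = ∑ x, ∑ S ∈ Finset.powersetCard s Finset.univ, if S ⊆ ones x then f x else 0 := by
          refine Finset.sum_congr rfl fun x _ => ?_
          have : (Finset.powersetCard s Finset.univ).filter (· ⊆ ones x)
              = Finset.powersetCard s (ones x) := by
            ext S; simp [Finset.mem_powersetCard, and_comm]
          rw [← Finset.sum_filter, this, Finset.sum_const, Finset.card_powersetCard,
            nsmul_eq_mul, mul_comm]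
      _ = ∑ S ∈ Finset.powersetCard s Finset.univ, prAll f S := by
          rw [Finset.sum_comm]; simp only [prAll_eq_sum_ite]
      _ = ∑ S ∈ Finset.powersetCard s (Finset.univ : Finset (Fin n)), p ^ s := by
          refine Finset.sum_congr rfl fun S hS => ?_
          have := (Finset.mem_powersetCard.1 hS).2
          rw [hf.prAll_eq S (this ▸ hs), this]
      _ = (n.choose s : ℝ) * p ^ s := by simp

/-- The exchangeable mass function whose number of ones has law `q`. -/
def exch (n : ℕ) (q : ℕ → ℝ) (x : Fin n → Bool) : ℝ :=
  q (ones x).card / (n.choose (ones x).card : ℝ)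

lemma prAll_exch {n k : ℕ} {p : ℝ} {q : ℕ → ℝ} (hq : IsProfile n k p q)
    (S : Finset (Fin n)) (hS : S.card ≤ k) : prAll (exch n q) S = p ^ S.card := by
  have hSn : S.card ≤ n := (Finset.card_le_univ S).trans_eq (Fintype.card_fin n)
  have hpos : (0 : ℝ) < n.choose S.card := by exact_mod_cast Nat.choose_pos hSn
  have key : prAll (exch n q) S * (n.choose S.card : ℝ)
      = ∑ j ∈ Finset.range (n + 1), q j * (j.choose S.card : ℝ) := by
    rw [prAll_eq_sum_ite]
    simp only [exch]
    rw [sum_ones fun T => if S ⊆ T then q T.card / (n.choose T.card : ℝ) else 0,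
      ← Finset.powerset_univ, Finset.sum_powerset, Finset.card_univ, Fintype.card_fin,
      Finset.sum_mul]
    refine Finset.sum_congr rfl fun j hj => ?_
    have hjn : j ≤ n := Nat.lt_succ_iff.1 (Finset.mem_range.1 hj)
    have hj0 : (n.choose j : ℝ) ≠ 0 := by exact_mod_cast (Nat.choose_pos hjn).ne'
    have h1 : ∑ T ∈ Finset.powersetCard j Finset.univ,
          (if S ⊆ T then q T.card / (n.choose T.card : ℝ) else 0)
        = ∑ T ∈ Finset.powersetCard j Finset.univ with S ⊆ T, q j / (n.choose j : ℝ) := by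
      rw [Finset.sum_filter]
      refine Finset.sum_congr rfl fun T hT => ?_
      rw [(Finset.mem_powersetCard.1 hT).2]
    rw [h1, Finset.sum_const, nsmul_eq_mul]
    rcases le_or_gt S.card j with hsj | hsj
    · rw [Finset.card_filter_powersetCard_subset S Finset.univ _ (Finset.subset_univ _) hsj]
      have := congrArg (Nat.cast (R := ℝ)) (Nat.choose_mul (n := n) hsj)
      push_cast at this
      rw [Finset.card_univ, Fintype.card_fin]
      field_simp
      linear_combination - q j * this
    · rw [Nat.choose_eq_zero_of_lt hsj, Finset.filter_eq_empty_iff.2]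
      · simp
      · intro T hT hST
        have := Finset.card_le_card hST
        rw [(Finset.mem_powersetCard.1 hT).2] at this
        omega
  rw [hq.2.2 _ hS, mul_comm] at key
  exact mul_left_cancel₀ hpos.ne' key

lemma memA_exch {n k : ℕ} {p : ℝ} {q : ℕ → ℝ} (hq : IsProfile n k p q) :
    memA n k p (exch n q) := by
  refine ⟨fun x => div_nonneg (hq.1 _) (Nat.cast_nonneg _), ?_, fun S _ hS => prAll_exch hq S hS⟩
  simpa [prAll_empty] using prAll_exch hq ∅ (by simp)

lemma prAll_exch_univ (n : ℕ) (q : ℕ → ℝ) : prAll (exch n q) Finset.univ = q n := by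
  rw [prAll_eq_sum_ite]
  simp only [exch]
  rw [sum_ones fun T => if Finset.univ ⊆ T then q T.card / (n.choose T.card : ℝ) else 0]
  simp [Finset.univ_subset_iff]

lemma M_eq_sSup_isProfile (n k : ℕ) (p : ℝ) :
    M n k p = sSup {y : ℝ | ∃ q, IsProfile n k p q ∧ q n = y} := by
  refine congrArg sSup (Set.ext fun y => ⟨?_, ?_⟩)
  · rintro ⟨f, hf, rfl⟩
    exact ⟨_, isProfile_weightLaw hf, weightLaw_self f⟩
  · rintro ⟨q, hq, rfl⟩
    exact ⟨_, memA_exch hq, prAll_exch_univ n q⟩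

lemma sum_mul_pow_mul_choose_eq_zero {N k : ℕ} {μ : ℕ → ℝ}
    (hμ : ∀ s ≤ k, ∑ j ∈ Finset.range N, μ j * (j.choose s : ℝ) = 0) (i s : ℕ) (his : i + s ≤ k) :
    ∑ j ∈ Finset.range N, μ j * ((j : ℝ) ^ i * (j.choose s : ℝ)) = 0 := by
  induction i generalizing s with
  | zero => simpa using hμ s (by omega)
  | succ i ih =>
    have h1 := ih (s + 1) (by omega)
    have h2 := ih s (by omega)
    have : ∀ j : ℕ, (j : ℝ) * (j.choose s : ℝ)
        = (s + 1) * (j.choose (s + 1) : ℝ) + s * (j.choose s : ℝ) := by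
      intro j
      have e1 := congrArg (Nat.cast (R := ℝ)) (Nat.add_one_mul_choose_eq j s)
      have e2 : ((j + 1).choose (s + 1) : ℝ) = j.choose s + j.choose (s + 1) := by
        exact_mod_cast Nat.choose_succ_succ j s
      push_cast at e1
      rw [e2] at e1
      linear_combination e1
    calc _ = (s + 1) * ∑ j ∈ Finset.range N, μ j * ((j : ℝ) ^ i * (j.choose (s + 1) : ℝ))
          + s * ∑ j ∈ Finset.range N, μ j * ((j : ℝ) ^ i * (j.choose s : ℝ)) := by
          rw [Finset.mul_sum, Finset.mul_sum, ← Finset.sum_add_distrib]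
          refine Finset.sum_congr rfl fun j _ => ?_
          linear_combination μ j * (j : ℝ) ^ i * this j
      _ = 0 := by rw [h1, h2]; ring

/-- A signed mass function with vanishing binomial moments up to order `k` annihilates all
polynomials of degree at most `k`. -/
lemma sum_mul_eval_eq_zero {N k : ℕ} {μ : ℕ → ℝ}
    (hμ : ∀ s ≤ k, ∑ j ∈ Finset.range N, μ j * (j.choose s : ℝ) = 0)
    (g : Polynomial ℝ) (hg : g.natDegree ≤ k) :
    ∑ j ∈ Finset.range N, μ j * g.eval (j : ℝ) = 0 := by
  simp_rw [Polynomial.eval_eq_sum_range, Finset.mul_sum]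
  rw [Finset.sum_comm]
  refine Finset.sum_eq_zero fun i hi => ?_
  have h := sum_mul_pow_mul_choose_eq_zero hμ i 0
    (by have := Finset.mem_range.1 hi; omega)
  calc _ = g.coeff i * ∑ j ∈ Finset.range N, μ j * ((j : ℝ) ^ i * (j.choose 0 : ℝ)) := by
        rw [Finset.mul_sum]
        refine Finset.sum_congr rfl fun j _ => ?_
        simp; ring
    _ = 0 := by rw [h, mul_zero]

lemma sum_binomial_mul_choose (n s : ℕ) (p : ℝ) :
    ∑ j ∈ Finset.range (n + 1),
      ((n.choose j : ℝ) * p ^ j * (1 - p) ^ (n - j)) * (j.choose s : ℝ)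
      = (n.choose s : ℝ) * p ^ s := by
  rcases lt_or_ge n s with hns | hsn
  · rw [Nat.choose_eq_zero_of_lt hns]
    simp only [Nat.cast_zero, zero_mul]
    refine Finset.sum_eq_zero fun j hj => ?_
    have hjs : j < s := by have := Finset.mem_range.1 hj; omega
    simp [Nat.choose_eq_zero_of_lt hjs]
  · obtain ⟨d, rfl⟩ := Nat.exists_eq_add_of_le hsn
    rw [add_assoc, Finset.sum_range_add, Finset.sum_eq_zero, zero_add]
    · calc _ = ((s + d).choose s : ℝ) * p ^ s * ∑ j ∈ Finset.range (d + 1),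
            p ^ j * (1 - p) ^ (d - j) * (d.choose j : ℝ) := by
            rw [Finset.mul_sum]
            refine Finset.sum_congr rfl fun j _ => ?_
            have := congrArg (Nat.cast (R := ℝ))
              (Nat.choose_mul (n := s + d) (Nat.le_add_right s j))
            simp only [Nat.add_sub_cancel_left] at this
            push_cast at this
            rw [Nat.add_sub_add_left, pow_add]
            linear_combination p ^ s * p ^ j * (1 - p) ^ (d - j) * this
        _ = _ := by rw [← add_pow]; simp
    · intro j hj
      rw [Nat.choose_eq_zero_of_lt (Finset.mem_range.1 hj)]
      simp

lemma IsProfile.le_one {n k : ℕ} {p : ℝ} {q : ℕ → ℝ} (hq : IsProfile n k p q) (j : ℕ) :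
    q j ≤ 1 := by
  have h := hq.2.2 0 (Nat.zero_le _)
  simp only [Nat.choose_zero_right, Nat.cast_one, mul_one, pow_zero] at h
  rcases lt_or_ge n j with hj | hj
  · rw [hq.2.1 j hj]; exact zero_le_one
  · rw [← h]
    exact Finset.single_le_sum (fun i _ => hq.1 i) (Finset.mem_range.2 (by omega))

lemma isCompact_setOf_isProfile (n k : ℕ) (p : ℝ) : IsCompact {q | IsProfile n k p q} := by
  refine (isCompact_univ_pi fun _ : ℕ => isCompact_Icc (a := (0 : ℝ)) (b := 1)).of_isClosed_subset
    ?_ fun q hq j _ => ⟨hq.1 j, hq.le_one j⟩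
  simp only [IsProfile, Set.ofPred_and, Set.ofPred_forall]
  refine IsClosed.inter ?_ (IsClosed.inter ?_ ?_)
  · exact isClosed_iInter fun j => isClosed_le (by fun_prop) (by fun_prop)
  · exact isClosed_iInter fun j => isClosed_iInter fun _ => isClosed_eq (by fun_prop) (by fun_prop)
  · exact isClosed_iInter fun j => isClosed_iInter fun _ => isClosed_eq (by fun_prop) (by fun_prop)

/-- A finite set of naturals is covered by pairs `{a, a + 1}` whose left endpoints lie in the set
and are at distance at least two from each other. -/
lemma exists_separated_cover (S : Finset ℕ) :
    ∃ A ⊆ S, (∀ a ∈ A, ∀ b ∈ A, a < b → a + 2 ≤ b) ∧ ∀ s ∈ S, s ∈ A ∨ ∃ a ∈ A, s = a + 1 := by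
  induction S using Finset.induction_on_max with
  | empty => exact ⟨∅, by simp⟩
  | insert m S hm ih =>
    obtain ⟨A, hAS, hsep, hcov⟩ := ih
    by_cases h : ∃ a ∈ A, m = a + 1
    · refine ⟨A, hAS.trans (Finset.subset_insert _ _), hsep, fun s hs => ?_⟩
      rcases Finset.mem_insert.1 hs with rfl | hs
      · exact Or.inr h
      · exact hcov s hs
    · push Not at h
      refine ⟨insert m A, Finset.insert_subset_insert _ hAS, fun a ha b hb hab => ?_,
        fun s hs => ?_⟩
      · have hlt : ∀ x ∈ A, x < m := fun x hx => hm x (hAS hx)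
        rcases Finset.mem_insert.1 ha with ha' | ha' <;>
          rcases Finset.mem_insert.1 hb with hb' | hb'
        · omega
        · have := hlt b hb'; omega
        · have := h a ha'; have := hlt a ha'; omega
        · exact hsep a ha' b hb' hab
      · rcases Finset.mem_insert.1 hs with rfl | hs
        · simp
        · rcases hcov s hs with hs | ⟨a, ha, rfl⟩
          · simp [hs]
          · exact Or.inr ⟨a, Finset.mem_insert_of_mem ha, rfl⟩

/-- The divided-difference weights on a set of nodes annihilate low-degree polynomials. -/
lemma sum_eval_div_prod_eq_zero (T : Finset ℕ) (g : Polynomial ℝ) (hg : g.natDegree + 1 < T.card) :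
    ∑ t ∈ T, g.eval (t : ℝ) / ∏ u ∈ T.erase t, ((t : ℝ) - u) = 0 := by
  have hdeg : g.degree < (T.card : WithBot ℕ) :=
    Polynomial.degree_le_natDegree.trans_lt (by exact_mod_cast (by omega : g.natDegree < T.card))
  rw [← Lagrange.coeff_eq_sum (v := fun t : ℕ => (t : ℝ)) Nat.cast_injective.injOn hdeg]
  exact Polynomial.coeff_eq_zero_of_natDegree_lt (by omega)

lemma exists_natDegree_le_eval_eq_choose (s : ℕ) :
    ∃ g : Polynomial ℝ, g.natDegree ≤ s ∧ ∀ j : ℕ, g.eval (j : ℝ) = (j.choose s : ℝ) := by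
  refine ⟨Polynomial.C ((s.factorial : ℝ)⁻¹) * descPochhammer ℝ s,
    (Polynomial.natDegree_C_mul_le _ _).trans (descPochhammer_natDegree ℝ s).le, fun j => ?_⟩
  have : (s.factorial : ℝ) ≠ 0 := by exact_mod_cast s.factorial_ne_zero
  rw [Polynomial.eval_mul, Polynomial.eval_C, descPochhammer_eval_eq_descFactorial,
    Nat.descFactorial_eq_factorial_mul_choose]
  push_cast
  field_simp

/-- Around separated points `Y` below `m` there is a signed mass function, supported in `[0, m]`,
that is negative only on `Y`, positive at `m`, and orthogonal to polynomials of degree at most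
`2 * Y.card - 2`. -/
lemma exists_signed_perturbation {m : ℕ} (Y : Finset ℕ) (hY : Y.Nonempty) (hYm : ∀ y ∈ Y, y < m)
    (hsep : ∀ a ∈ Y, ∀ b ∈ Y, a < b → a + 2 ≤ b) :
    ∃ μ : ℕ → ℝ, (∀ j ∉ Y, 0 ≤ μ j) ∧ (∀ j, m < j → μ j = 0) ∧ 0 < μ m ∧
      ∀ s, s + 2 ≤ 2 * Y.card → ∑ j ∈ Finset.range (m + 1), μ j * (j.choose s : ℝ) = 0 := by
  set y := Y.max' hY
  have hyY : y ∈ Y := Y.max'_mem hY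
  have hle : ∀ a ∈ Y, a ≤ y := fun a ha => Y.le_max' a ha
  have hym := hYm y hyY
  set Z := Y.erase y with hZ
  have hZY : ∀ a, a ∈ Z ↔ a ∈ Y ∧ a ≠ y := fun a => by simp [hZ, and_comm]
  have hZlt : ∀ a ∈ Z, a + 2 ≤ y := fun a ha => by
    have h := (hZY a).1 ha
    exact hsep a h.1 y hyY (lt_of_le_of_ne (hle a h.1) h.2)
  have hsepZ : ∀ a ∈ Y, ∀ b ∈ Z, a ≠ b + 1 := fun a ha b hb h => by
    have := hsep b ((hZY b).1 hb).1 a ha (by omega)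
    omega
  have hYinsert : Y = insert y Z := (Finset.insert_erase hyY).symm
  set T := insert m (Y ∪ Z.image (· + 1)) with hT
  have hTm : ∀ t ∈ T, t ≤ m := by
    intro t ht
    simp only [hT, Finset.mem_insert, Finset.mem_union, Finset.mem_image] at ht
    rcases ht with rfl | ht | ⟨a, ha, rfl⟩
    · rfl
    · exact (hYm t ht).le
    · have := hZlt a ha; omega
  have hTcard : T.card = 2 * Y.card := by
    have hdisj : Disjoint Y (Z.image (· + 1)) := by
      rw [Finset.disjoint_left]
      intro a ha h
      obtain ⟨b, hb, rfl⟩ := Finset.mem_image.1 h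
      exact hsepZ _ ha b hb rfl
    have hm : m ∉ Y ∪ Z.image (· + 1) := by
      simp only [Finset.mem_union, Finset.mem_image, not_or, not_exists, not_and]
      exact ⟨fun h => (hYm m h).ne rfl, fun a ha h => by have := hZlt a ha; omega⟩
    rw [hT, Finset.card_insert_of_notMem hm, Finset.card_union_of_disjoint hdisj,
      Finset.card_image_of_injective _ (add_left_injective 1), hZ, Finset.card_erase_of_mem hyY]
    have := hY.card_pos
    omega
  have hmT : m ∈ T := Finset.mem_insert_self _ _
  have hmpos : 0 < ∏ u ∈ T.erase m, ((m : ℝ) - u) := by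
    refine Finset.prod_pos fun u hu => sub_pos.2 ?_
    have h := Finset.mem_erase.1 hu
    exact_mod_cast lt_of_le_of_ne (hTm u h.2) h.1
  have hZpos : ∀ a ∈ Z, 0 < ∏ u ∈ T.erase (a + 1), (((a + 1 : ℕ) : ℝ) - u) := by
    intro a ha
    have hay := hZlt a ha
    have hTa : T.erase (a + 1)
        = insert m (insert y (insert a (Z.erase a ∪ (Z.erase a).image (· + 1)))) := by
      ext u
      simp only [hT, Finset.mem_erase, Finset.mem_insert, Finset.mem_union, Finset.mem_image]
      constructor
      · rintro ⟨hu, rfl | h | ⟨b, hb, rfl⟩⟩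
        · simp
        · rw [hYinsert, Finset.mem_insert] at h
          tauto
        · refine Or.inr (Or.inr (Or.inr (Or.inr ⟨b, ⟨?_, hb⟩, rfl⟩)))
          omega
      · rintro (rfl | rfl | rfl | ⟨-, h⟩ | ⟨b, ⟨hba, hb⟩, rfl⟩)
        · exact ⟨by omega, Or.inl rfl⟩
        · exact ⟨by omega, Or.inr (Or.inl hyY)⟩
        · exact ⟨by omega, Or.inr (Or.inl ((hZY _).1 ha).1)⟩
        · exact ⟨hsepZ u ((hZY u).1 h).1 a ha, Or.inr (Or.inl ((hZY u).1 h).1)⟩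
        · exact ⟨by omega, Or.inr (Or.inr ⟨b, hb, rfl⟩)⟩
    have hdisj : Disjoint (Z.erase a) ((Z.erase a).image (· + 1)) := by
      rw [Finset.disjoint_left]
      intro c hc h
      obtain ⟨b, hb, rfl⟩ := Finset.mem_image.1 h
      exact hsepZ _ ((hZY _).1 (Finset.mem_of_mem_erase hc)).1 b (Finset.mem_of_mem_erase hb) rfl
    have ha' : a ∉ Z.erase a ∪ (Z.erase a).image (· + 1) := by
      simp only [Finset.mem_union, Finset.mem_image, Finset.mem_erase, not_or, not_exists]
      exact ⟨by simp, fun b hb => hsepZ a ((hZY a).1 ha).1 b hb.1.2 hb.2.symm⟩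
    have hy' : y ∉ insert a (Z.erase a ∪ (Z.erase a).image (· + 1)) := by
      simp only [Finset.mem_insert, Finset.mem_union, Finset.mem_image, Finset.mem_erase, not_or,
        not_exists]
      exact ⟨by omega, fun h => by have := hZlt y h.2; omega,
        fun b hb => by have := hZlt b hb.1.2; omega⟩
    have hm' : m ∉ insert y (insert a (Z.erase a ∪ (Z.erase a).image (· + 1))) := by
      simp only [Finset.mem_insert, Finset.mem_union, Finset.mem_image, Finset.mem_erase, not_or,
        not_exists]
      exact ⟨by omega, by omega, fun h => by have := hZlt m h.2; omega,
        fun b hb => by have := hZlt b hb.1.2; omega⟩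
    rw [hTa, Finset.prod_insert hm', Finset.prod_insert hy', Finset.prod_insert ha',
      Finset.prod_union hdisj, Finset.prod_image (fun _ _ _ _ h => Nat.succ_injective h),
      ← Finset.prod_mul_distrib, ← mul_assoc]
    have hym' : (y : ℝ) < m := by exact_mod_cast hym
    have hay' : (a : ℝ) + 2 ≤ y := by exact_mod_cast hay
    refine mul_pos (mul_pos_of_neg_of_neg ?_ ?_) (mul_pos ?_ (Finset.prod_pos fun b hb => ?_))
    · push_cast; linarith
    · push_cast; linarith
    · push_cast; linarith
    · obtain ⟨hba, hb⟩ := Finset.mem_erase.1 hb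
      push_cast
      have haY := ((hZY a).1 ha).1
      have hbY := ((hZY b).1 hb).1
      rcases lt_or_gt_of_ne hba with h | h
      · have : (b : ℝ) + 2 ≤ a := by exact_mod_cast hsep b hbY a haY h
        exact mul_pos (by linarith) (by linarith)
      · have : (a : ℝ) + 2 ≤ b := by exact_mod_cast hsep a haY b hbY h
        exact mul_pos_of_neg_of_neg (by linarith) (by linarith)
  refine ⟨fun t => if t ∈ T then (∏ u ∈ T.erase t, ((t : ℝ) - u))⁻¹ else 0, fun j hj => ?_,
    fun j hj => ?_, ?_, fun s hs => ?_⟩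
  · by_cases hjT : j ∈ T
    · simp only [if_pos hjT, inv_nonneg]
      have h := hjT
      simp only [hT, Finset.mem_insert, Finset.mem_union, Finset.mem_image] at h
      rcases h with rfl | h | ⟨a, ha, rfl⟩
      · exact hmpos.le
      · exact absurd h hj
      · exact (hZpos a ha).le
    · simp [hjT]
  · exact if_neg fun h => absurd (hTm j h) (by omega)
  · simp only [if_pos hmT, inv_pos]
    exact hmpos
  · obtain ⟨g, hg, hgs⟩ := exists_natDegree_le_eval_eq_choose s
    have hsub : T ⊆ Finset.range (m + 1) := fun t ht =>
      Finset.mem_range.2 (Nat.lt_succ_of_le (hTm t ht))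
    refine Eq.trans (Eq.symm ?_) (sum_eval_div_prod_eq_zero T g (by omega))
    refine Finset.sum_subset_zero_on_sdiff hsub (fun j hj => ?_) fun j hj => ?_
    · simp only [if_neg (Finset.mem_sdiff.1 hj).2, zero_mul]
    · simp only [if_pos hj, hgs, div_eq_inv_mul]

/-- The support of a profile maximising the mass at `m` contains no `k / 2 + 1` separated points
below `m`. -/
lemma card_le_of_isMax {m k : ℕ} {p : ℝ} {q : ℕ → ℝ} (hk : Even k) (hq : IsProfile m k p q)
    (hmax : ∀ q', IsProfile m k p q' → q' m ≤ q m) (A : Finset ℕ)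
    (hA : ∀ a ∈ A, a < m ∧ 0 < q a) (hsep : ∀ a ∈ A, ∀ b ∈ A, a < b → a + 2 ≤ b) :
    2 * A.card ≤ k := by
  by_contra hcon
  obtain ⟨r, rfl⟩ := hk
  obtain ⟨Y, hYA, hYcard⟩ := Finset.exists_subset_card_eq (s := A) (n := r + 1) (by omega)
  obtain ⟨μ, hμ0, hμm, hμpos, hμs⟩ := exists_signed_perturbation Y
    (Finset.card_pos.1 (by omega)) (fun y hy => (hA y (hYA hy)).1)
    (fun a ha b hb => hsep a (hYA ha) b (hYA hb))
  obtain ⟨ε, hε, hεpos⟩ : ∃ ε : ℝ, (∀ t ∈ Y, 0 < q t + ε * μ t) ∧ 0 < ε := by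
    have h : ∀ᶠ ε : ℝ in nhdsWithin 0 (Set.Ioi 0), ∀ t ∈ Y, 0 < q t + ε * μ t := by
      rw [Filter.eventually_all_finset]
      intro t ht
      have hc : Continuous fun ε : ℝ => q t + ε * μ t := by fun_prop
      refine (hc.tendsto 0).eventually_const_lt ?_ |>.filter_mono nhdsWithin_le_nhds
      simpa using (hA t (hYA ht)).2
    exact (h.and self_mem_nhdsWithin).exists
  have hq' : IsProfile m (r + r) p fun j => q j + ε * μ j := by
    refine ⟨fun j => ?_, fun j hj => ?_, fun s hs => ?_⟩
    · by_cases hj : j ∈ Y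
      · exact (hε j hj).le
      · exact add_nonneg (hq.1 j) (mul_nonneg hεpos.le (hμ0 j hj))
    · simp [hq.2.1 j hj, hμm j hj]
    · simp only [add_mul, Finset.sum_add_distrib, mul_assoc, ← Finset.mul_sum]
      rw [hq.2.2 s hs, hμs s (by omega), mul_zero, add_zero]
  have := hmax _ hq'
  linarith [mul_pos hεpos hμpos]

lemma isProfile_sizeBias {m k : ℕ} {p : ℝ} (hp : 0 < p) {q : ℕ → ℝ}
    (hq : IsProfile (m + 1) (k + 1) p q) :
    IsProfile m k p fun j => (j + 1) * q (j + 1) / ((m + 1) * p) := by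
  have hm : (0 : ℝ) < m + 1 := by positivity
  refine ⟨fun j => ?_, fun j hj => ?_, fun s hs => ?_⟩
  · have := hq.1 (j + 1)
    positivity
  · simp [hq.2.1 (j + 1) (by omega)]
  · have h := hq.2.2 (s + 1) (by omega)
    rw [Finset.sum_range_succ', Nat.choose_zero_succ, Nat.cast_zero, mul_zero, add_zero] at h
    have hc : ∀ j : ℕ, ((j : ℝ) + 1) * j.choose s = (j + 1).choose (s + 1) * (s + 1) := fun j => by
      exact_mod_cast Nat.add_one_mul_choose_eq j s
    calc _ = (s + 1) / ((m + 1) * p) * ∑ j ∈ Finset.range (m + 1),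
          q (j + 1) * ((j + 1).choose (s + 1) : ℝ) := by
          rw [Finset.mul_sum]
          refine Finset.sum_congr rfl fun j _ => ?_
          field_simp
          linear_combination q (j + 1) * hc j
      _ = _ := by
          rw [h]
          field_simp
          linear_combination - p ^ (s + 1) * hc m

/-- Inverse of size-biasing: the masses at `1, …, m + 1` are determined by `q`, the mass at `0` by
normalisation. -/
def unbias (m : ℕ) (p : ℝ) (q : ℕ → ℝ) : ℕ → ℝ
  | 0 => 1 - ∑ j ∈ Finset.range (m + 1), (m + 1) * p * q j / (j + 1)
  | j + 1 => (m + 1) * p * q j / (j + 1)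

lemma sum_unbias_mul_choose {m k : ℕ} {p : ℝ} {q : ℕ → ℝ} (hq : IsProfile m k p q)
    (s : ℕ) (hs : s ≤ k + 1) :
    ∑ j ∈ Finset.range (m + 1 + 1), unbias m p q j * (j.choose s : ℝ)
      = ((m + 1).choose s : ℝ) * p ^ s := by
  rw [Finset.sum_range_succ']
  cases s with
  | zero => simp [unbias]
  | succ s =>
    have hc : ∀ j : ℕ, ((j : ℝ) + 1) * j.choose s = (j + 1).choose (s + 1) * (s + 1) := fun j => by
      exact_mod_cast Nat.add_one_mul_choose_eq j s
    rw [Nat.choose_zero_succ, Nat.cast_zero, mul_zero, add_zero]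
    calc _ = (m + 1) * p / (s + 1) * ∑ j ∈ Finset.range (m + 1), q j * (j.choose s : ℝ) := by
          rw [Finset.mul_sum]
          refine Finset.sum_congr rfl fun j _ => ?_
          have : (0 : ℝ) < j + 1 := by positivity
          simp only [unbias]
          field_simp
          linear_combination - p * q j * hc j
      _ = _ := by
          rw [hq.2.2 s (by omega)]
          field_simp
          linear_combination p ^ (s + 1) * hc m

lemma unbias_zero_nonneg {m k : ℕ} {p : ℝ} (hp : p ∈ Set.Icc (0 : ℝ) 1) {q : ℕ → ℝ} (hk : Even k)
    (hq : IsProfile m k p q) (hmax : ∀ q', IsProfile m k p q' → q' m ≤ q m) :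
    0 ≤ unbias m p q 0 := by
  obtain ⟨A, hAS, hsep, hcov⟩ := exists_separated_cover ((Finset.range m).filter (0 < q ·))
  have hA : ∀ a ∈ A, a < m ∧ 0 < q a := fun a ha => by simpa using hAS ha
  have hcard := card_le_of_isMax hk hq hmax A hA hsep
  let g : Polynomial ℝ := (Polynomial.C ((m : ℝ) + 1) - Polynomial.X) *
    ∏ a ∈ A, ((Polynomial.X - Polynomial.C ((a : ℝ) + 1)) *
      (Polynomial.X - Polynomial.C ((a : ℝ) + 2)))
  have hgeval : ∀ x : ℝ, g.eval x = (m + 1 - x) * ∏ a ∈ A, ((x - (a + 1)) * (x - (a + 2))) :=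
    fun x => by simp [g, Polynomial.eval_prod]
  have hgdeg : g.natDegree ≤ k + 1 := by
    have h1 : (Polynomial.C ((m : ℝ) + 1) - Polynomial.X).natDegree ≤ 1 := by compute_degree
    have h2 : (∏ a ∈ A, ((Polynomial.X - Polynomial.C ((a : ℝ) + 1)) *
        (Polynomial.X - Polynomial.C ((a : ℝ) + 2)))).natDegree ≤ ∑ _a ∈ A, 2 :=
      (Polynomial.natDegree_prod_le _ _).trans
        (Finset.sum_le_sum fun a _ => by compute_degree)
    have := Polynomial.natDegree_mul_le_of_le h1 h2
    simp only [Finset.sum_const, smul_eq_mul] at this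
    exact this.trans (by omega)
  have hgnonneg : ∀ j ∈ Finset.range (m + 1 + 1), 0 ≤ g.eval (j : ℝ) := by
    intro j hj
    have hj : j ≤ m + 1 := Nat.lt_succ_iff.1 (Finset.mem_range.1 hj)
    rw [hgeval]
    refine mul_nonneg (sub_nonneg.2 (by exact_mod_cast hj)) (Finset.prod_nonneg fun a _ => ?_)
    rcases le_or_gt j (a + 1) with h | h
    · have : (j : ℝ) ≤ a + 1 := by exact_mod_cast h
      exact mul_nonneg_of_nonpos_of_nonpos (by linarith) (by linarith)
    · have : (a : ℝ) + 2 ≤ j := by exact_mod_cast h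
      exact mul_nonneg (by linarith) (by linarith)
  have hg0 : 0 < g.eval 0 := by
    rw [hgeval]
    refine mul_pos (by rw [sub_zero]; positivity) (Finset.prod_pos fun a _ => ?_)
    exact mul_pos_of_neg_of_neg (by rw [zero_sub, neg_lt_zero]; positivity)
      (by rw [zero_sub, neg_lt_zero]; positivity)
  have hgzero : ∀ j ∈ Finset.range (m + 1),
      unbias m p q (j + 1) * g.eval ((j + 1 : ℕ) : ℝ) = 0 := by
    intro j hj
    have hj : j ≤ m := Nat.lt_succ_iff.1 (Finset.mem_range.1 hj)
    rw [hgeval, unbias]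
    rcases hj.eq_or_lt with rfl | hjm
    · simp
    rcases (hq.1 j).eq_or_lt with h0 | h0
    · simp [← h0]
    have hprod : ∏ a ∈ A, ((((j + 1 : ℕ) : ℝ) - (a + 1)) * (((j + 1 : ℕ) : ℝ) - (a + 2))) = 0 := by
      rcases hcov j (by simp [hjm, h0]) with h | ⟨a, ha, rfl⟩
      · exact Finset.prod_eq_zero h (by push_cast; ring)
      · exact Finset.prod_eq_zero ha (by push_cast; ring)
    rw [hprod, mul_zero, mul_zero]
  let b : ℕ → ℝ := fun j => ((m + 1).choose j : ℝ) * p ^ j * (1 - p) ^ (m + 1 - j)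
  have hdiff := sum_mul_eval_eq_zero (N := m + 1 + 1) (k := k + 1)
    (μ := fun j => unbias m p q j - b j) (fun s hs => by
      simp only [sub_mul, Finset.sum_sub_distrib]
      rw [sum_unbias_mul_choose hq s hs, sum_binomial_mul_choose, sub_self]) g hgdeg
  simp only [sub_mul, Finset.sum_sub_distrib] at hdiff
  rw [Finset.sum_range_succ', Finset.sum_eq_zero hgzero, zero_add, Nat.cast_zero] at hdiff
  have hb : 0 ≤ ∑ j ∈ Finset.range (m + 1 + 1), b j * g.eval (j : ℝ) :=
    Finset.sum_nonneg fun j hj => mul_nonneg (mul_nonneg (mul_nonneg (Nat.cast_nonneg _)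
      (pow_nonneg hp.1 _)) (pow_nonneg (sub_nonneg.2 hp.2) _)) (hgnonneg j hj)
  exact nonneg_of_mul_nonneg_left (by linarith) hg0

lemma isProfile_unbias {m k : ℕ} {p : ℝ} (hp : p ∈ Set.Icc (0 : ℝ) 1) {q : ℕ → ℝ} (hk : Even k)
    (hq : IsProfile m k p q) (hmax : ∀ q', IsProfile m k p q' → q' m ≤ q m) :
    IsProfile (m + 1) (k + 1) p (unbias m p q) := by
  refine ⟨fun j => ?_, fun j hj => ?_, sum_unbias_mul_choose hq⟩
  · cases j with
    | zero => exact unbias_zero_nonneg hp hk hq hmax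
    | succ j =>
      have := hq.1 j
      have := hp.1
      simp only [unbias]
      positivity
  · obtain ⟨j, rfl⟩ := Nat.exists_eq_succ_of_ne_zero (by omega : j ≠ 0)
    simp [unbias, hq.2.1 j (by omega)]

lemma bddAbove_isProfile (n k : ℕ) (p : ℝ) :
    BddAbove {y : ℝ | ∃ q, IsProfile n k p q ∧ q n = y} :=
  ⟨1, by rintro _ ⟨q, hq, rfl⟩; exact hq.le_one n⟩

lemma M_nonneg (n k : ℕ) (p : ℝ) : 0 ≤ M n k p := by
  rw [M_eq_sSup_isProfile]
  exact Real.sSup_nonneg (by rintro _ ⟨q, hq, rfl⟩; exact hq.1 n)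

/-- for even positive `k` and `k + 1 ≤ n`, `M(n, k+1, p) = p * M(n-1, k, p)`. -/
theorem stmt3 (n k : ℕ) (hk : 0 < k) (hke : Even k) (hkn : k + 1 ≤ n) (p : ℝ)
    (hp : p ∈ Set.Icc (0:ℝ) 1) :
    M n (k + 1) p = p * M (n - 1) k p := by
  obtain ⟨m, rfl⟩ := Nat.exists_eq_succ_of_ne_zero (by omega : n ≠ 0)
  simp only [Nat.succ_eq_add_one, Nat.add_sub_cancel]
  apply le_antisymm
  · rw [M_eq_sSup_isProfile (m + 1)]
    refine Real.sSup_le ?_ (mul_nonneg hp.1 (M_nonneg _ _ _))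
    rintro _ ⟨q, hq, rfl⟩
    rcases hp.1.eq_or_lt with rfl | hp0
    · have h := hq.2.2 1 (by omega)
      simp only [Nat.choose_one_right, pow_one, mul_zero] at h
      have h' := (Finset.sum_eq_zero_iff_of_nonneg fun j _ =>
        mul_nonneg (hq.1 j) (Nat.cast_nonneg j)).1 h (m + 1) (Finset.mem_range.2 (by omega))
      have h0 : q (m + 1) = 0 := (mul_eq_zero.1 h').resolve_right (by positivity)
      rw [h0, zero_mul]
    · have h : q (m + 1) / p ≤ M m k p := by
        rw [M_eq_sSup_isProfile]
        refine le_csSup (bddAbove_isProfile m k p) ⟨_, isProfile_sizeBias hp0 hq, ?_⟩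
        have : (0 : ℝ) < m + 1 := by positivity
        field_simp
      exact (div_le_iff₀' hp0).1 h
  · rcases {q | IsProfile m k p q}.eq_empty_or_nonempty with hempty | hne
    · have h0 : M m k p = 0 := by
        rw [M_eq_sSup_isProfile]
        convert! Real.sSup_empty
        refine Set.eq_empty_of_forall_notMem ?_
        rintro _ ⟨q, hq, -⟩
        exact Set.eq_empty_iff_forall_notMem.1 hempty q hq
      rw [h0, mul_zero]
      exact M_nonneg _ _ _
    · obtain ⟨q, hq, hmax⟩ := (isCompact_setOf_isProfile m k p).exists_isMaxOn hne
        (continuous_apply m).continuousOn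
      have hmax' : ∀ q', IsProfile m k p q' → q' m ≤ q m := fun q' hq' => hmax hq'
      have hM : M m k p ≤ q m := by
        rw [M_eq_sSup_isProfile]
        refine Real.sSup_le ?_ (hq.1 m)
        rintro _ ⟨q', hq', rfl⟩
        exact hmax' q' hq'
      refine (mul_le_mul_of_nonneg_left hM hp.1).trans ?_
      rw [M_eq_sSup_isProfile (m + 1)]
      refine le_csSup (bddAbove_isProfile _ _ _) ⟨_, isProfile_unbias hp hke hq hmax', ?_⟩
      have : (0 : ℝ) < m + 1 := by positivity
      simp only [unbias]
      field_simp
end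
end

section
/- Let 2 ≤ k ≤ n−1 be integers with k even. Then for every p ∈ [0,1], M(n,k,p) ≤ B(n, k, 1−p). -/
open scoped BigOperators

noncomputable section

lemma Finset.prod_one_sub_eq_sum_powerset {ι R : Type*} [CommRing R] (s : Finset ι) (f : ι → R) :
    ∏ i ∈ s, (1 - f i) = ∑ t ∈ s.powerset, (-1) ^ t.card * ∏ i ∈ t, f i := by
  simp_rw [sub_eq_neg_add, Finset.prod_add_one, Finset.prod_neg]

/-- The product measure of `n` Bernoulli(`p`) bits assigns probability `p ^ #S` to the event that
all coordinates in `S` are `1`. -/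
lemma prAll_prod (n : ℕ) (p : ℝ) (S : Finset (Fin n)) :
    prAll (fun x : Fin n → Bool => ∏ i, if x i = true then p else 1 - p) S = p ^ S.card := by
  have h : (Finset.univ.filter fun x : Fin n → Bool => ∀ i ∈ S, x i = true) =
      Fintype.piFinset fun i => if i ∈ S then {true} else Finset.univ := by
    ext x
    simp only [Finset.mem_filter, Finset.mem_univ, true_and, Fintype.mem_piFinset]
    refine forall_congr' fun i => ?_
    by_cases hi : i ∈ S <;> simp [hi]
  rw [prAll, h, ← Finset.prod_univ_sum (fun i => if i ∈ S then {true} else Finset.univ)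
    (fun _ b => if b = true then p else 1 - p)]
  have h' : ∀ i : Fin n, (∑ b ∈ (if i ∈ S then {true} else Finset.univ : Finset Bool),
      if b = true then p else 1 - p) = if i ∈ S then p else 1 := by
    intro i
    by_cases hi : i ∈ S <;> simp [hi]
  rw [Finset.prod_congr rfl fun i _ => h' i]
  simp

lemma memA_prod (n k : ℕ) (p : ℝ) (hp : p ∈ Set.Icc (0 : ℝ) 1) :
    memA n k p fun x => ∏ i, if x i = true then p else 1 - p := by
  refine ⟨fun x => Finset.prod_nonneg fun i _ => ?_, ?_, fun S _ _ => prAll_prod n p S⟩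
  · split_ifs
    · exact hp.1
    · linarith [hp.2]
  · simpa [prAll] using prAll_prod n p ∅

/-- Under a `k`-wise independent measure, at most `k` given coordinates vanish simultaneously with
probability a power of `1 - p`. -/
lemma memA.sum_forall_false {n k : ℕ} {p : ℝ} {f : (Fin n → Bool) → ℝ} (hf : memA n k p f)
    (T : Finset (Fin n)) (hT : T.card ≤ k) :
    ∑ x, (if ∀ i ∈ T, x i = false then f x else 0) = (1 - p) ^ T.card := by
  have hS : ∀ S ⊆ T, ∑ x, f x * ∏ i ∈ S, (if x i = true then (1 : ℝ) else 0) =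
      p ^ S.card := by
    intro S hST
    have h1 : ∑ x, f x * ∏ i ∈ S, (if x i = true then (1 : ℝ) else 0) = prAll f S := by
      rw [prAll, Finset.sum_filter]
      refine Finset.sum_congr rfl fun x _ => ?_
      rw [Finset.prod_boole]
      simp
    rw [h1]
    rcases S.eq_empty_or_nonempty with rfl | hne
    · simpa [prAll] using hf.2.1
    · exact hf.2.2 S hne.card_pos ((Finset.card_le_card hST).trans hT)
  have hexp : ∀ x : Fin n → Bool, (if ∀ i ∈ T, x i = false then f x else 0) =
      ∑ S ∈ T.powerset, (-1) ^ S.card *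
        (f x * ∏ i ∈ S, (if x i = true then (1 : ℝ) else 0)) := by
    intro x
    have h2 : (if ∀ i ∈ T, x i = false then f x else 0) =
        f x * ∏ i ∈ T, (1 - if x i = true then (1 : ℝ) else 0) := by
      have h3 : ∀ i, (1 - if x i = true then (1 : ℝ) else 0) = if x i = false then 1 else 0 := by
        intro i
        cases x i <;> simp
      simp only [h3, Finset.prod_boole]
      simp
    rw [h2, Finset.prod_one_sub_eq_sum_powerset, Finset.mul_sum]
    exact Finset.sum_congr rfl fun S _ => by ring
  simp_rw [hexp]
  rw [Finset.sum_comm]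
  simp_rw [← Finset.mul_sum]
  have hp' : (1 - p) ^ T.card = ∏ _i ∈ T, (1 - p) := by simp
  rw [hp', Finset.prod_one_sub_eq_sum_powerset]
  refine Finset.sum_congr rfl fun S hS' => ?_
  rw [hS S (Finset.mem_powerset.1 hS'), Finset.prod_const]

/-- The `i`-th binomial moment of the number of zeros. -/
lemma memA.sum_mul_choose {n k : ℕ} {p : ℝ} {f : (Fin n → Bool) → ℝ} (hf : memA n k p f)
    {i : ℕ} (hi : i ≤ k) :
    ∑ x, f x * ((Finset.univ.filter fun j => x j = false).card.choose i : ℝ) =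
      n.choose i * (1 - p) ^ i := by
  have h : ∀ x : Fin n → Bool,
      f x * ((Finset.univ.filter fun j => x j = false).card.choose i : ℝ) =
      ∑ T ∈ (Finset.univ : Finset (Fin n)).powersetCard i,
        if ∀ j ∈ T, x j = false then f x else 0 := by
    intro x
    rw [← Finset.sum_filter, Finset.sum_const, ← Finset.card_powersetCard, nsmul_eq_mul, mul_comm]
    congr 3
    ext T
    simp [Finset.mem_powersetCard, Finset.subset_iff, and_comm]
  simp_rw [h]
  rw [Finset.sum_comm, Finset.sum_congr (g := fun _ => (1 - p) ^ i) rfl fun T hT => by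
    rw [hf.sum_forall_false T ((Finset.mem_powersetCard.1 hT).2.trans_le hi),
      (Finset.mem_powersetCard.1 hT).2]]
  simp

lemma alternating_sum_choose_nonneg {k : ℕ} (hk : Even k) {m : ℕ} (hm : m ≠ 0) :
    0 ≤ ∑ i ∈ Finset.range (k + 1), (-1 : ℝ) ^ i * (m.choose i) := by
  obtain ⟨m, rfl⟩ := Nat.exists_eq_succ_of_ne_zero hm
  have h : ∑ i ∈ Finset.range (k + 1), (-1 : ℝ) ^ i * ((m + 1).choose i) =
      (-1) ^ k * (m.choose k) := by
    clear hk
    induction k with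
    | zero => simp
    | succ k ih =>
      rw [Finset.sum_range_succ, ih, Nat.choose_succ_succ]
      push_cast
      ring
  rw [Nat.succ_eq_add_one, h, hk.neg_one_pow]
  positivity

lemma memA.prAll_univ_le {n k : ℕ} (hke : Even k) {p : ℝ} {f : (Fin n → Bool) → ℝ}
    (hf : memA n k p f) : prAll f Finset.univ ≤ bonf n (k : ℤ) (1 - p) := by
  have hb : bonf n (k : ℤ) (1 - p) = ∑ x, f x * ∑ i ∈ Finset.range (k + 1),
      (-1 : ℝ) ^ i * ((Finset.univ.filter fun j => x j = false).card.choose i) := by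
    simp_rw [Finset.mul_sum]
    rw [Finset.sum_comm, bonf, if_neg (by omega), Int.toNat_natCast]
    refine Finset.sum_congr rfl fun i hi => ?_
    rw [mul_assoc, ← hf.sum_mul_choose (Nat.lt_succ_iff.1 (Finset.mem_range.1 hi)),
      Finset.mul_sum]
    exact Finset.sum_congr rfl fun x _ => by ring
  rw [hb, prAll, Finset.sum_filter]
  refine Finset.sum_le_sum fun x _ => ?_
  by_cases hx : ∀ j, x j = true
  · have h0 : (Finset.univ.filter fun j => x j = false).card = 0 := by simp [hx]
    rw [h0, Finset.sum_range_succ']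
    simp [hx]
  · have h0 : (Finset.univ.filter fun j => x j = false).card ≠ 0 := by
      simpa [Finset.filter_eq_empty_iff] using hx
    simpa [hx] using mul_nonneg (hf.1 x) (alternating_sum_choose_nonneg hke h0)

/-- for even `k`, `M(n,k,p) ≤ B(n,k,1-p)`. -/
theorem stmt5 (n k : ℕ) (hk : 2 ≤ k) (hkn : k + 1 ≤ n) (hke : Even k)
    (p : ℝ) (hp : p ∈ Set.Icc (0:ℝ) 1) :
    M n k p ≤ bonf n (k : ℤ) (1 - p) := by
  refine csSup_le ⟨_, _, memA_prod n k p hp, rfl⟩ ?_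
  rintro y ⟨f, hf, rfl⟩
  exact hf.prAll_univ_le hke
end
end

section
/- Let 2 ≤ k ≤ n−2 be integers and set p₁ = 1/(n−k+1). Then there exists a real number p₂ > p₁ such that for all p ∈ [p₁, p₂], M(n,k,p) = (1/C(n−k+1, 2)) · p^{k−2} · B(n−k+2, 2, p). -/
open scoped BigOperators

noncomputable section

/-- The Bonferroni polynomial with a natural number truncation degree. -/
def bonfNat (m l : ℕ) (x : ℝ) : ℝ :=
  ∑ i ∈ Finset.range (l + 1), (-1 : ℝ) ^ i * (m.choose i) * x ^ i

lemma bonf_natCast (m l : ℕ) (x : ℝ) : bonf m l x = bonfNat m l x := by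
  have h : ¬ ((l : ℤ) < 0) := by omega
  simp [bonf, bonfNat, h]

lemma bonfNat_zero_right (m : ℕ) (x : ℝ) : bonfNat m 0 x = 1 := by
  simp [bonfNat]

lemma bonfNat_zero_left (l : ℕ) (x : ℝ) : bonfNat 0 l x = 1 := by
  simp [bonfNat, Finset.sum_range_succ']

lemma bonfNat_succ_right (m l : ℕ) (x : ℝ) :
    bonfNat m (l + 1) x = bonfNat m l x + (-x) ^ (l + 1) * (m.choose (l + 1)) := by
  rw [bonfNat, Finset.sum_range_succ, ← bonfNat, neg_pow x]
  ring

lemma bonfNat_succ_succ (m l : ℕ) (x : ℝ) :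
    bonfNat (m + 1) (l + 1) x = bonfNat m (l + 1) x - x * bonfNat m l x := by
  unfold bonfNat
  rw [Finset.sum_range_succ', Finset.sum_range_succ' _ (l + 1), Finset.mul_sum,
    add_sub_right_comm, ← Finset.sum_sub_distrib]
  congr 1
  · refine Finset.sum_congr rfl fun i _ => ?_
    rw [Nat.choose_succ_succ]
    push_cast
    ring
  · simp

lemma bonfNat_succ_succ' (m l : ℕ) (x : ℝ) :
    bonfNat (m + 1) (l + 1) x
      = (1 - x) * bonfNat m l x + (-x) ^ (l + 1) * (m.choose (l + 1)) := by
  rw [bonfNat_succ_succ, bonfNat_succ_right]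
  ring

lemma bonfNat_two (m : ℕ) (x : ℝ) :
    bonfNat m 2 x = 1 - m * x + (m * (m - 1) / 2) * x ^ 2 := by
  simp [bonfNat, Finset.sum_range_succ, Nat.cast_choose_two]
  ring

lemma continuous_bonfNat (m l : ℕ) : Continuous (bonfNat m l) := by
  unfold bonfNat
  fun_prop

/-- Passing from one odd truncation degree to the next one. -/
lemma bonfNat_add_two_pos {d l : ℕ} (hd : 2 ≤ d) (hl : Odd l)
    (h : 0 ≤ bonfNat (d + l) l (1 / ((d : ℝ) + 1))) :
    0 < bonfNat (d + l + 2) (l + 2) (1 / ((d : ℝ) + 1)) := by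
  have hd' : (2 : ℝ) ≤ d := by exact_mod_cast hd
  set x : ℝ := 1 / ((d : ℝ) + 1) with hx
  have hx0 : 0 < x := by positivity
  have hxd : x * (d + 1) = 1 := by rw [hx]; field_simp
  have hx1 : 0 ≤ 1 - x := by nlinarith
  rw [bonfNat_succ_succ' (d + l + 1), bonfNat_succ_succ' (d + l)]
  have e1 : (-x) ^ (l + 1) = x ^ (l + 1) := Even.neg_pow hl.add_one x
  have e2 : (-x) ^ (l + 1 + 1) = - (x ^ (l + 1) * x) := by
    rw [pow_succ, e1]; ring
  rw [e1, e2]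
  have hc : ((d + l + 1).choose (l + 2) : ℝ) * (l + 2)
      = (d + l + 1) * ((d + l).choose (l + 1)) := by
    have := Nat.add_one_mul_choose_eq (d + l) (l + 1)
    exact_mod_cast this.symm
  have hc0 : (0 : ℝ) < (d + l).choose (l + 1) := by
    exact_mod_cast Nat.choose_pos (by omega)
  set c : ℝ := ((d + l).choose (l + 1) : ℝ)
  set c' : ℝ := ((d + l + 1).choose (l + 2) : ℝ) with hc'
  have hl0 : (0 : ℝ) ≤ l := by positivity
  have key : x * c' < (1 - x) * c := by
    have h1 : (1 - x) = x * d := by linarith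
    have h2 : c' < d * c := by
      have : c' * (l + 2) < d * c * (l + 2) := by
        rw [hc]
        nlinarith [mul_pos hc0 (show (0 : ℝ) < (d - 1) * (l + 1) by
          apply mul_pos <;> linarith)]
      exact lt_of_mul_lt_mul_right this (by linarith)
    rw [h1, mul_assoc]
    exact mul_lt_mul_of_pos_left h2 hx0
  have hp := mul_pos (pow_pos hx0 (l + 1)) (sub_pos.2 key)
  have hq := mul_nonneg (mul_nonneg hx1 hx1) h
  nlinarith

lemma bonfNat_odd_nonneg {d : ℕ} (hd : 2 ≤ d) (r : ℕ) :
    0 ≤ bonfNat (d + (2 * r + 1)) (2 * r + 1) (1 / ((d : ℝ) + 1)) := by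
  induction r with
  | zero =>
    refine le_of_eq ?_
    simp [bonfNat, Finset.sum_range_succ]
    field_simp
    ring
  | succ r ih => exact (bonfNat_add_two_pos hd (odd_two_mul_add_one r) ih).le

lemma bonfNat_pos {d l : ℕ} (hd : 2 ≤ d) (hl : l ≠ 1) :
    0 < bonfNat (d + l) l (1 / ((d : ℝ) + 1)) := by
  rcases Nat.even_or_odd' l with ⟨r, rfl | rfl⟩
  · cases r with
    | zero => simp [bonfNat_zero_right]
    | succ r =>
      have hx0 : (0 : ℝ) < 1 / ((d : ℝ) + 1) := by positivity
      have hx1 : (0 : ℝ) ≤ 1 - 1 / ((d : ℝ) + 1) := by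
        rw [sub_nonneg, div_le_one (by positivity)]
        simp
      have hc : (0 : ℝ) < (d + (2 * r + 1)).choose (2 * r + 1 + 1) := by
        exact_mod_cast Nat.choose_pos (by omega)
      have e : (-(1 / ((d : ℝ) + 1))) ^ (2 * r + 1 + 1) = (1 / ((d : ℝ) + 1)) ^ (2 * r + 1 + 1) :=
        Even.neg_pow (odd_two_mul_add_one r).add_one _
      have h := bonfNat_succ_succ' (d + (2 * r + 1)) (2 * r + 1) (1 / ((d : ℝ) + 1))
      rw [e] at h
      have h' : 0 < bonfNat (d + (2 * r + 1) + 1) (2 * r + 1 + 1) (1 / ((d : ℝ) + 1)) := by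
        rw [h]
        exact add_pos_of_nonneg_of_pos (mul_nonneg hx1 (bonfNat_odd_nonneg hd r))
          (mul_pos (pow_pos hx0 _) hc)
      exact h'
  · cases r with
    | zero => simp at hl
    | succ r => exact bonfNat_add_two_pos hd (odd_two_mul_add_one r) (bonfNat_odd_nonneg hd r)

/-- If `g a` is the probability that `a` given coordinates are `1`, for an exchangeable measure,
then `exchProb g a b` is the probability that `a` given coordinates are `1` and `b` other ones
are `0`. -/
def exchProb (g : ℕ → ℝ) : ℕ → ℕ → ℝ
  | a, 0 => g a
  | a, b + 1 => exchProb g a b - exchProb g (a + 1) b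

/-- The exchangeable (signed) mass function with moments `g`. -/
def exchMass (n : ℕ) (g : ℕ → ℝ) (x : Fin n → Bool) : ℝ :=
  exchProb g (Finset.univ.filter fun i => x i = true).card
    (Finset.univ.filter fun i => x i = false).card

lemma sum_exchMass {n : ℕ} (g : ℕ → ℝ) (r : ℕ) (S Z : Finset (Fin n)) (hSZ : Disjoint S Z)
    (hr : (S ∪ Z)ᶜ.card = r) :
    ∑ x ∈ Finset.univ.filter
        (fun x : Fin n → Bool => (∀ i ∈ S, x i = true) ∧ ∀ i ∈ Z, x i = false), exchMass n g x
      = exchProb g S.card Z.card := by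
  induction r generalizing S Z with
  | zero =>
    have hu : ∀ i, i ∈ S ∨ i ∈ Z := fun i => by
      have : i ∉ (S ∪ Z)ᶜ := by rw [Finset.card_eq_zero.1 hr]; simp
      simp at this
      tauto
    have hd : ∀ i, i ∈ S → i ∉ Z := fun i h => Finset.disjoint_left.1 hSZ h
    rw [Finset.sum_eq_single_of_mem (fun i => decide (i ∈ S))]
    · unfold exchMass
      congr 2 <;> ext i <;> have := hu i <;> have := hd i <;> simp <;> tauto
    · simp only [Finset.mem_filter, Finset.mem_univ, true_and, decide_eq_true_eq,
        decide_eq_false_iff_not]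
      exact ⟨fun i h => h, fun i h h' => hd i h' h⟩
    · intro y hy hne
      refine absurd ?_ hne
      simp only [Finset.mem_filter, Finset.mem_univ, true_and] at hy
      funext i
      rcases hu i with h | h
      · simp [hy.1 i h, h]
      · simpa [hy.2 i h] using fun h' => hd i h' h
  | succ r ih =>
    obtain ⟨i, hi⟩ : ((S ∪ Z)ᶜ).Nonempty := Finset.card_pos.1 (by omega)
    have hiS : i ∉ S := by simp at hi; tauto
    have hiZ : i ∉ Z := by simp at hi; tauto
    have h1 := ih (insert i S) Z (by simp [hiZ, hSZ]) (by
      rw [Finset.insert_union, Finset.compl_insert, Finset.card_erase_of_mem hi, hr]; rfl)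
    have h2 := ih S (insert i Z) (by simp [hiS, hSZ]) (by
      rw [Finset.union_insert, Finset.compl_insert, Finset.card_erase_of_mem hi, hr]; rfl)
    rw [Finset.card_insert_of_notMem hiS] at h1
    rw [Finset.card_insert_of_notMem hiZ, exchProb] at h2
    rw [← Finset.sum_filter_add_sum_filter_not _ (fun x : Fin n → Bool => x i = true),
      Finset.filter_filter, Finset.filter_filter]
    rw [show exchProb g S.card Z.card = exchProb g (S.card + 1) Z.card
      + (exchProb g S.card Z.card - exchProb g (S.card + 1) Z.card) by ring, ← h2, ← h1]
    congr 2 <;> ext x <;> simp <;> tauto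

lemma prAll_exchMass {n : ℕ} (g : ℕ → ℝ) (S : Finset (Fin n)) :
    prAll (exchMass n g) S = g S.card := by
  have := sum_exchMass g _ S ∅ (by simp) rfl
  simpa [exchProb, prAll] using this

/-- Moments `p ^ s` up to order `k`, constant equal to `t` beyond. -/
def truncMoment (k : ℕ) (p t : ℝ) (s : ℕ) : ℝ := if s ≤ k then p ^ s else t

lemma exchProb_truncMoment_of_lt {k a : ℕ} (p t : ℝ) (b : ℕ) (ha : k < a) :
    exchProb (truncMoment k p t) a b = if b = 0 then t else 0 := by
  induction b generalizing a with
  | zero => simp [exchProb, truncMoment, ha]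
  | succ b ih => simp [exchProb, ih ha, ih (ha.trans (Nat.lt_succ_self a))]

lemma exchProb_truncMoment {k : ℕ} (p t : ℝ) (b a l : ℕ) (h : a + l = k) :
    exchProb (truncMoment k p t) a b
      = p ^ a * bonfNat b l p - t * bonfNat b l 1 + if b = 0 then t else 0 := by
  induction b generalizing a l with
  | zero => simp [exchProb, truncMoment, bonfNat_zero_left, show a ≤ k by omega]
  | succ b ih =>
    rw [exchProb, ih a l h]
    cases l with
    | zero =>
      rw [exchProb_truncMoment_of_lt p t b (show k < a + 1 by omega)]
      simp [bonfNat_zero_right]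
    | succ l =>
      rw [ih (a + 1) l (by omega), bonfNat_succ_succ, bonfNat_succ_succ]
      simp only [Nat.add_eq_zero_iff, one_ne_zero, and_false, if_false]
      ring

/-- If all the weights are nonnegative, the truncated moment sequence is realised by a
`k`-wise independent measure. -/
lemma memA_exchMass {k d : ℕ} {p t : ℝ} (hd : 0 < d) (ht : 0 ≤ t)
    (h : ∀ l ≤ k, 0 ≤ p ^ (k - l) * bonfNat (d + l) l p - t * bonfNat (d + l) l 1) :
    memA (k + d) k p (exchMass (k + d) (truncMoment k p t)) := by
  refine ⟨fun x => ?_, ?_, fun S _ hS => ?_⟩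
  · unfold exchMass
    have hc : (Finset.univ.filter fun i => x i = true).card
        + (Finset.univ.filter fun i => x i = false).card = k + d := by
      have := Finset.card_filter_add_card_filter_not (s := Finset.univ) (fun i => x i = true)
      simpa using this
    set a := (Finset.univ.filter fun i => x i = true).card
    set b := (Finset.univ.filter fun i => x i = false).card
    rcases le_or_gt a k with ha | ha
    · have := h (k - a) (by omega)
      rw [show k - (k - a) = a by omega, show d + (k - a) = b by omega] at this
      rw [exchProb_truncMoment p t b a (k - a) (by omega)]
      simpa [show b ≠ 0 by omega] using this
    · rw [exchProb_truncMoment_of_lt p t b ha]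
      split_ifs <;> simp [ht]
  · have := prAll_exchMass (n := k + d) (truncMoment k p t) ∅
    simpa [prAll, truncMoment] using this
  · rw [prAll_exchMass, truncMoment, if_pos hS]

lemma sum_powersetCard_prAll {n : ℕ} (f : (Fin n → Bool) → ℝ) (S T : Finset (Fin n)) (s : ℕ) :
    ∑ U ∈ T.powersetCard s, prAll f (S ∪ U)
      = ∑ x ∈ Finset.univ.filter (fun x : Fin n → Bool => ∀ i ∈ S, x i = true),
          f x * ((T.filter fun i => x i = true).card.choose s) := by
  unfold prAll
  rw [Finset.sum_congr rfl (g := fun U => ∑ x ∈ Finset.univ.filter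
    (fun x : Fin n → Bool => ∀ i ∈ S, x i = true), if ∀ i ∈ U, x i = true then f x else 0)]
  · rw [Finset.sum_comm]
    refine Finset.sum_congr rfl fun x _ => ?_
    rw [← Finset.sum_filter, Finset.sum_const, nsmul_eq_mul, mul_comm, ← Finset.card_powersetCard]
    congr 3
    ext U
    simp only [Finset.mem_filter, Finset.mem_powersetCard, Finset.subset_iff]
    grind
  · intro U _
    rw [← Finset.sum_filter, Finset.filter_filter]
    congr 1
    ext x
    simp only [Finset.mem_filter, Finset.mem_union]
    grind

lemma prAll_univ {n : ℕ} (f : (Fin n → Bool) → ℝ) :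
    prAll f Finset.univ = f fun _ => true := by
  unfold prAll
  rw [Finset.sum_eq_single_of_mem (fun _ => true)]
  · simp
  · intro y hy hne
    exact absurd (funext (by simpa using hy)) hne

lemma one_sub_add_choose_two_nonneg (y : ℕ) : (0 : ℝ) ≤ 1 - y + (y.choose 2 : ℝ) := by
  rw [Nat.cast_choose_two]
  rcases y with _ | _ | y
  · simp
  · simp
  · have : (0 : ℝ) ≤ y := by positivity
    push_cast
    nlinarith

lemma memA.prAll_univ_le_s11 {j d : ℕ} {p : ℝ} {f : (Fin (j + 2 + d) → Bool) → ℝ}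
    (hf : memA (j + 2 + d) (j + 2) p f) :
    prAll f Finset.univ * ((d + 1).choose 2) ≤ p ^ j * bonfNat (d + 2) 2 p := by
  obtain ⟨hf0, hf1, hfS⟩ := hf
  have hS' : ∀ S : Finset (Fin (j + 2 + d)), S.card ≤ j + 2 → prAll f S = p ^ S.card := by
    intro S hS
    rcases Nat.eq_zero_or_pos S.card with h | h
    · rw [Finset.card_eq_zero.1 h]
      simpa [prAll] using hf1
    · exact hfS S h hS
  obtain ⟨S, -, hS⟩ := Finset.exists_subset_card_eq
    (show j ≤ (Finset.univ : Finset (Fin (j + 2 + d))).card by simp; omega)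
  have hSc : Sᶜ.card = d + 2 := by
    rw [Finset.card_compl, hS, Fintype.card_fin]; omega
  have key : ∀ s ≤ 2, ∑ x ∈ Finset.univ.filter
      (fun x : Fin (j + 2 + d) → Bool => ∀ i ∈ S, x i = true),
          f x * ((Sᶜ.filter fun i => x i = true).card.choose s : ℝ)
        = (d + 2).choose s * p ^ (j + s) := by
    intro s hs
    rw [← sum_powersetCard_prAll, Finset.sum_congr rfl (g := fun _ => p ^ (j + s))]
    · rw [Finset.sum_const, Finset.card_powersetCard, hSc, nsmul_eq_mul]
    · intro U hU
      rw [Finset.mem_powersetCard] at hU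
      have : (S ∪ U).card = j + s := by
        rw [Finset.card_union_of_disjoint, hS, hU.2]
        exact Finset.disjoint_of_subset_right hU.1 disjoint_compl_right
      rw [hS' _ (by omega), this]
  have h0 := key 0 (by norm_num)
  have h1 := key 1 (by norm_num)
  have h2 := key 2 le_rfl
  have hsum : ∑ x ∈ Finset.univ.filter
      (fun x : Fin (j + 2 + d) → Bool => ∀ i ∈ S, x i = true),
          f x * (1 - ((Sᶜ.filter fun i => x i = true).card : ℝ)
            + ((Sᶜ.filter fun i => x i = true).card.choose 2 : ℝ))
        = p ^ j * bonfNat (d + 2) 2 p := by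
    simp only [Nat.choose_zero_right, Nat.choose_one_right] at h0 h1
    simp only [mul_add, mul_sub, Finset.sum_add_distrib, Finset.sum_sub_distrib]
    rw [h1, h2]
    simp only [Nat.cast_one] at h0
    rw [h0, bonfNat_two, Nat.cast_choose_two]
    ring
  rw [← hsum, prAll_univ]
  refine le_trans (le_of_eq ?_) (Finset.single_le_sum (f := fun x => f x *
    (1 - ((Sᶜ.filter fun i => x i = true).card : ℝ)
      + ((Sᶜ.filter fun i => x i = true).card.choose 2 : ℝ)))
    (fun x _ => mul_nonneg (hf0 x) (one_sub_add_choose_two_nonneg _))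
    (show (fun _ => true) ∈ _ by simp))
  simp only [Finset.filter_true, hSc, Nat.cast_choose_two]
  push_cast
  ring

/-- The optimal value on the second interval, for `k = j + 2` and `n = k + d`. -/
def optVal (j d : ℕ) (p : ℝ) : ℝ :=
  (1 / ((d + 1).choose 2 : ℝ)) * p ^ j * bonfNat (d + 2) 2 p

lemma choose_two_mul_optVal {j d : ℕ} (hd : 1 ≤ d) (p : ℝ) :
    ((d + 1).choose 2 : ℝ) * optVal j d p = p ^ j * bonfNat (d + 2) 2 p := by
  have : ((d + 1).choose 2 : ℝ) ≠ 0 := by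
    exact_mod_cast (Nat.choose_pos (show 2 ≤ d + 1 by omega)).ne'
  unfold optVal
  field_simp

lemma continuous_optVal (j d : ℕ) : Continuous (optVal j d) := by
  have := continuous_bonfNat (d + 2) 2
  unfold optVal
  fun_prop

lemma choose_two_mul_pow_sub_optVal {j d : ℕ} (hd : 1 ≤ d) (p : ℝ) :
    ((d + 1).choose 2 : ℝ) * (p ^ (j + 2) - optVal j d p)
      = p ^ j * ((1 - p) * ((d + 1) * p - 1)) := by
  rw [mul_sub, choose_two_mul_optVal hd, bonfNat_two, Nat.cast_choose_two]
  push_cast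
  ring

lemma optVal_left_endpoint {j d : ℕ} (hd : 1 ≤ d) :
    optVal j d (1 / ((d : ℝ) + 1)) = (1 / ((d : ℝ) + 1)) ^ (j + 2) := by
  have h := choose_two_mul_pow_sub_optVal (j := j) hd (1 / ((d : ℝ) + 1))
  have hc : ((d + 1).choose 2 : ℝ) ≠ 0 := by
    exact_mod_cast (Nat.choose_pos (show 2 ≤ d + 1 by omega)).ne'
  rw [mul_one_div_cancel (by positivity), sub_self, mul_zero, mul_zero] at h
  linarith [(mul_eq_zero.1 h).resolve_left hc]

lemma bonfNat_succ_one (m l : ℕ) : bonfNat (m + 1) l 1 = (-1) ^ l * (m.choose l) := by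
  cases l with
  | zero => simp [bonfNat_zero_right]
  | succ l => simp [bonfNat_succ_succ']

lemma weight_left_endpoint_pos {j d l : ℕ} (hd : 2 ≤ d) (hl : l + 1 ≤ j + 2) (hl1 : l ≠ 1) :
    0 < (1 / ((d : ℝ) + 1)) ^ (j + 2 - (l + 1)) * bonfNat (d + (l + 1)) (l + 1) (1 / ((d : ℝ) + 1))
      - optVal j d (1 / ((d : ℝ) + 1)) * bonfNat (d + (l + 1)) (l + 1) 1 := by
  have hpos := bonfNat_pos hd hl1
  rw [optVal_left_endpoint (by omega), ← add_assoc, bonfNat_succ_one, bonfNat_succ_succ']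
  have hx0 : (0 : ℝ) < 1 / ((d : ℝ) + 1) := by positivity
  have hx1 : (0 : ℝ) < 1 - 1 / ((d : ℝ) + 1) := by
    rw [sub_pos, div_lt_one (by positivity)]
    have : (2 : ℝ) ≤ d := by exact_mod_cast hd
    linarith
  set x : ℝ := 1 / ((d : ℝ) + 1)
  have e : x ^ (j + 2) = x ^ (j + 2 - (l + 1)) * x ^ (l + 1) := by
    rw [← pow_add]; congr 1; omega
  rw [e, neg_pow x]
  have := mul_pos (pow_pos hx0 (j + 2 - (l + 1))) (mul_pos hx1 hpos)
  nlinarith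

lemma M_eq_optVal {j d : ℕ} {p : ℝ} (hd : 1 ≤ d) (ht : 0 ≤ optVal j d p)
    (h : ∀ l ≤ j + 2, 0 ≤ p ^ (j + 2 - l) * bonfNat (d + l) l p
      - optVal j d p * bonfNat (d + l) l 1) :
    M (j + 2 + d) (j + 2) p = optVal j d p := by
  have hc : (0 : ℝ) < (d + 1).choose 2 := by
    exact_mod_cast Nat.choose_pos (show 2 ≤ d + 1 by omega)
  refine IsGreatest.csSup_eq ⟨⟨_, memA_exchMass (by omega) ht h, ?_⟩, ?_⟩
  · rw [prAll_exchMass, truncMoment, if_neg]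
    simp
    omega
  · rintro y ⟨f, hf, rfl⟩
    have h1 := hf.prAll_univ_le_s11
    rw [← choose_two_mul_optVal hd, mul_comm] at h1
    exact le_of_mul_le_mul_left h1 hc

/-- `M(n,k,p)` on the second interval: there is `p₂ > p₁ = 1/(n-k+1)`
such that `M(n,k,p) = (1/C(n-k+1,2)) p^{k-2} B(n-k+2, 2, p)` on `[p₁, p₂]`. -/
theorem stmt11 (n k : ℕ) (hk : 2 ≤ k) (hkn : k + 2 ≤ n) :
    ∃ p₂ : ℝ, 1 / ((n:ℝ) - (k:ℝ) + 1) < p₂ ∧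
      ∀ p ∈ Set.Icc (1 / ((n:ℝ) - (k:ℝ) + 1)) p₂,
        M n k p = (1 / ((n - k + 1).choose 2 : ℝ)) * p ^ (k - 2) * bonf (n - k + 2) 2 p := by
  obtain ⟨j, rfl⟩ := Nat.exists_eq_add_of_le' hk
  obtain ⟨d, rfl⟩ := Nat.exists_eq_add_of_le (show j + 2 ≤ n by omega)
  have hd : 2 ≤ d := by omega
  have hp₁ : 1 / (((j + 2 + d : ℕ) : ℝ) - ((j + 2 : ℕ) : ℝ) + 1) = 1 / ((d : ℝ) + 1) := by
    push_cast
    ring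
  rw [hp₁, show j + 2 + d - (j + 2) = d by omega]
  have hd0 : (0 : ℝ) < (d : ℝ) + 1 := by positivity
  have hx0 : (0 : ℝ) < 1 / ((d : ℝ) + 1) := by positivity
  have hx1 : 1 / ((d : ℝ) + 1) < 1 := by
    rw [div_lt_one hd0]
    have : (2 : ℝ) ≤ d := by exact_mod_cast hd
    linarith
  have hev : ∀ᶠ p in nhds (1 / ((d : ℝ) + 1)), (p < 1 ∧ 0 < optVal j d p) ∧
      ∀ l ∈ Finset.range (j + 2), l ≠ 1 →
        0 < p ^ (j + 2 - (l + 1)) * bonfNat (d + (l + 1)) (l + 1) p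
          - optVal j d p * bonfNat (d + (l + 1)) (l + 1) 1 := by
    have hopt := continuous_optVal j d
    refine ((eventually_lt_nhds hx1).and (hopt.continuousAt.eventually (lt_mem_nhds ?_))).and ?_
    · rw [optVal_left_endpoint (by omega)]
      positivity
    · rw [Filter.eventually_all_finset]
      intro l hl
      by_cases hl1 : l = 1
      · simp [hl1]
      have hb := continuous_bonfNat (d + (l + 1)) (l + 1)
      have hw : Continuous fun p : ℝ => p ^ (j + 2 - (l + 1)) * bonfNat (d + (l + 1)) (l + 1) p
          - optVal j d p * bonfNat (d + (l + 1)) (l + 1) 1 := by fun_prop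
      filter_upwards [hw.continuousAt.eventually
        (lt_mem_nhds (weight_left_endpoint_pos hd (Finset.mem_range.1 hl) hl1))] with p hp _
      exact hp
  obtain ⟨ε, hε, hball⟩ := Metric.eventually_nhds_iff.1 hev
  refine ⟨1 / ((d : ℝ) + 1) + ε / 2, by linarith, fun p hp => ?_⟩
  obtain ⟨⟨hp1, ht⟩, hw⟩ := hball (y := p) (by
    rw [Real.dist_eq, abs_of_nonneg (by linarith [hp.1])]
    linarith [hp.2])
  rw [show (2 : ℤ) = ((2 : ℕ) : ℤ) by rfl, bonf_natCast]
  refine M_eq_optVal (by omega) ht.le fun l hl => ?_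
  rcases l with _ | _ | _ | l
  · have hc : (0 : ℝ) < (d + 1).choose 2 := by
      exact_mod_cast Nat.choose_pos (show 2 ≤ d + 1 by omega)
    have h := choose_two_mul_pow_sub_optVal (j := j) (show 1 ≤ d by omega) p
    have hp0 : 0 ≤ p := hx0.le.trans hp.1
    have hdp : 0 ≤ ((d : ℝ) + 1) * p - 1 := by
      have := (div_le_iff₀ hd0).1 hp.1
      linarith
    have : 0 ≤ ((d + 1).choose 2 : ℝ) * (p ^ (j + 2) - optVal j d p) := by
      rw [h]
      exact mul_nonneg (pow_nonneg hp0 j) (mul_nonneg (by linarith) hdp)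
    simpa [bonfNat_zero_right] using nonneg_of_mul_nonneg_right this hc
  · exact (hw 0 (by simp) (by norm_num)).le
  · have h := choose_two_mul_optVal (j := j) (show 1 ≤ d by omega) p
    have h1 := bonfNat_succ_one (d + 1) 2
    norm_num at h1
    simp only [zero_add, Nat.reduceAdd, Nat.add_sub_cancel]
    rw [h1]
    linarith
  · exact (hw (l + 2) (by simp; omega) (by omega)).le
end
end
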